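/- arXiv:0807.1994 — 5 statements merged into one kernel-verified Lean document; each statement's English description precedes it below -/
import Mathlib

section
/- Let H be a separable infinite-dimensional complex Hilbert space. The set of unitary operators on H is residual (i.e., its complement is meagre) in the set of all linear isometries of H into itself, where the set of isometries carries the strong operator topology. -/
/-- Two orthogonal vectors of equal norm are exchanged by the reflection in the hyperplane
orthogonal to their difference. -/
theorem reflection_orthogonal_sub_eq_of_inner_eq_zero
    {H : Type*} [NormedAddCommGroup H] [InnerProductSpace ℂ H] {a b : H}
    (hab : inner ℂ a b = 0) (hn : ‖a‖ = ‖b‖) :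
    (ℂ ∙ (a - b))ᗮ.reflection a = b := by
  have hsub : (ℂ ∙ (a - b))ᗮ.reflection (a - b) = -(a - b) :=
    Submodule.reflection_orthogonalComplement_singleton_eq_neg (𝕜 := ℂ) (a - b)
  have hadd : (ℂ ∙ (a - b))ᗮ.reflection (a + b) = a + b := by
    apply Submodule.reflection_mem_subspace_eq_self
    rw [Submodule.mem_orthogonal_singleton_iff_inner_right]
    have hba : inner ℂ b a = 0 := inner_eq_zero_symm.mp hab
    simp [inner_sub_left, inner_add_right, hab, hba, inner_self_eq_norm_sq_to_K, hn]
  rw [map_sub] at hsub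
  rw [map_add] at hadd
  have h2 : (2 : ℂ) • (ℂ ∙ (a - b))ᗮ.reflection a = (2 : ℂ) • b := by
    rw [two_smul, two_smul]
    calc _ = ((ℂ ∙ (a - b))ᗮ.reflection a - (ℂ ∙ (a - b))ᗮ.reflection b)
          + ((ℂ ∙ (a - b))ᗮ.reflection a + (ℂ ∙ (a - b))ᗮ.reflection b) := by abel
      _ = b + b := by rw [hsub, hadd]; abel
  exact smul_right_injective H two_ne_zero h2

/-- A linear isometry of an infinite-dimensional Hilbert space can be modified off a
finite-dimensional subspace so that a given vector lies in its range. -/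
theorem exists_isometry_eqOn_finiteDimensional_mem_range
    {H : Type*} [NormedAddCommGroup H] [InnerProductSpace ℂ H] [CompleteSpace H]
    (hinf : ¬ FiniteDimensional ℂ H) (T : H →L[ℂ] H) (hT : ∀ x, ‖T x‖ = ‖x‖)
    (F : Submodule ℂ H) [FiniteDimensional ℂ F] (d : H) :
    ∃ V : H →L[ℂ] H, (∀ x, ‖V x‖ = ‖x‖) ∧ (∀ x ∈ F, V x = T x) ∧ ∃ x, V x = d := by
  let G : Submodule ℂ H := F.map (T : H →ₗ[ℂ] H)
  let K : Submodule ℂ H := F ⊔ ℂ ∙ (T.adjoint d)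
  have hK : Kᗮ ≠ ⊥ := by
    rw [Ne, Submodule.orthogonal_eq_bot_iff]
    intro h
    have : FiniteDimensional ℂ (⊤ : Submodule ℂ H) := h ▸ inferInstanceAs (FiniteDimensional ℂ K)
    exact hinf (Module.finite_def.mpr (Module.Finite.iff_fg.mp this))
  obtain ⟨e, he, he0⟩ := Submodule.exists_mem_ne_zero_of_ne_bot hK
  have inner_map (x y : H) : inner ℂ (T x) (T y) = inner ℂ x y :=
    LinearIsometry.inner_map_map (⟨(T : H →ₗ[ℂ] H), hT⟩ : H →ₗᵢ[ℂ] H) x y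
  let u : H := d - G.starProjection d
  have hu : u ∈ Gᗮ := Submodule.sub_starProjection_mem_orthogonal d
  obtain ⟨f, hf, hTf⟩ := Submodule.mem_map.mp (Submodule.starProjection_apply_mem G d)
  let c : ℂ := ((‖u‖ / ‖e‖ : ℝ) : ℂ)
  have hTe : T e ∈ Gᗮ := by
    rw [Submodule.mem_orthogonal]
    rintro _ ⟨y, hy, rfl⟩
    exact (inner_map y e).trans
      (Submodule.inner_right_of_mem_orthogonal (Submodule.mem_sup_left hy) he)
  have hed : inner ℂ (T e) d = 0 := by
    rw [← ContinuousLinearMap.adjoint_inner_right]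
    exact Submodule.inner_left_of_mem_orthogonal
      (Submodule.mem_sup_right (Submodule.mem_span_singleton_self _)) he
  have heu : inner ℂ (T (c • e)) u = 0 := by
    have := Submodule.inner_left_of_mem_orthogonal (Submodule.starProjection_apply_mem G d) hTe
    simp [u, hed, this]
  have hnorm : ‖T (c • e)‖ = ‖u‖ := by
    have : ‖e‖ ≠ 0 := norm_ne_zero_iff.mpr he0
    rw [hT, norm_smul, Complex.norm_real, Real.norm_of_nonneg (by positivity)]
    field_simp
  let R := (ℂ ∙ (T (c • e) - u))ᗮ.reflection
  have hR : ∀ x ∈ F, R (T x) = T x := by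
    intro x hx
    apply Submodule.reflection_mem_subspace_eq_self
    rw [Submodule.mem_orthogonal_singleton_iff_inner_left]
    apply Submodule.inner_right_of_mem_orthogonal (K := G) ⟨x, hx, rfl⟩
    rw [map_smul]
    exact Gᗮ.sub_mem (Gᗮ.smul_mem c hTe) hu
  refine ⟨(R.toContinuousLinearEquiv : H →L[ℂ] H).comp T, fun x => ?_, hR, c • e + f, ?_⟩
  · exact (R.norm_map _).trans (hT x)
  · change R (T (c • e + f)) = d
    rw [map_add, map_add, hR f hf]
    have h1 : R (T (c • e)) = u := reflection_orthogonal_sub_eq_of_inner_eq_zero heu hnorm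
    have h2 : T f = G.starProjection d := hTf
    rw [h1, h2, sub_add_cancel]

/-- On a separable infinite-dimensional complex Hilbert space, the set of unitary
operators (i.e., surjective isometries) is residual — its complement is meagre —
in the set of all linear isometries, endowed with the strong operator topology. -/
theorem unitaries_residual_in_isometries_sot
    {H : Type*} [NormedAddCommGroup H] [InnerProductSpace ℂ H] [CompleteSpace H]
    [TopologicalSpace.SeparableSpace H] (hinf : ¬ FiniteDimensional ℂ H) :
    @IsMeagre {T : H →L[ℂ] H // ∀ x : H, ‖T x‖ = ‖x‖}
      (TopologicalSpace.induced
        (fun (T : {T : H →L[ℂ] H // ∀ x : H, ‖T x‖ = ‖x‖}) (x : H) => T.1 x)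
        Pi.topologicalSpace)
      {T | ¬ Function.Surjective (T.1 : H → H)} := by
  let X := {T : H →L[ℂ] H // ∀ x : H, ‖T x‖ = ‖x‖}
  let ev : X → H → H := fun T x => T.1 x
  let τ : TopologicalSpace X := TopologicalSpace.induced ev Pi.topologicalSpace
  change @IsMeagre X τ {T | ¬ Function.Surjective (T.1 : H → H)}
  have hev (x : H) : @Continuous X H τ _ (fun T => T.1 x) :=
    (continuous_apply x).comp (continuous_induced_dom (f := ev))
  let U (n m : ℕ) : Set X :=
    ⋃ x : H, {T | dist (T.1 x) (TopologicalSpace.denseSeq H n) < 1 / ((m : ℝ) + 1)}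
  have hopen (n m : ℕ) : @IsOpen X τ (U n m) :=
    @isOpen_iUnion X H τ _ fun x => (hev x).dist continuous_const |>.isOpen_preimage _ isOpen_Iio
  have hdense (n m : ℕ) : @Dense X τ (U n m) := by
    intro T
    rw [@mem_closure_iff_nhds X τ]
    intro s hs
    rw [nhds_induced, Filter.mem_comap] at hs
    obtain ⟨t, ht, hts⟩ := hs
    rw [nhds_pi, Filter.mem_pi] at ht
    obtain ⟨I, hI, w, hw, hwt⟩ := ht
    have : FiniteDimensional ℂ (Submodule.span ℂ I) := FiniteDimensional.span_of_finite ℂ hI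
    obtain ⟨V, hV, hVT, x, hx⟩ := exists_isometry_eqOn_finiteDimensional_mem_range hinf T.1 T.2
      (Submodule.span ℂ I) (TopologicalSpace.denseSeq H n)
    refine ⟨⟨V, hV⟩, hts (hwt fun i hi => ?_), Set.mem_iUnion.mpr ⟨x, ?_⟩⟩
    · change V i ∈ w i
      rw [hVT i (Submodule.subset_span hi)]
      exact mem_of_mem_nhds (hw i)
    · change dist (V x) _ < _
      rw [hx, dist_self]
      positivity
  have hres : (⋂ n, ⋂ m, U n m) ∈ @residual X τ :=
    countable_iInter_mem.mpr fun n => countable_iInter_mem.mpr fun m =>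
      @residual_of_dense_open X τ _ (hopen n m) (hdense n m)
  refine Filter.mem_of_superset hres fun T hTU => ?_
  rw [Set.mem_compl_iff, Set.mem_ofPred_eq, not_not]
  have hclosed : IsClosed (Set.range T.1) :=
    (AddMonoidHomClass.isometry_of_norm T.1 T.2).isClosedEmbedding.isClosed_range
  have hsub : Set.range (TopologicalSpace.denseSeq H) ⊆ Set.range T.1 := by
    rintro _ ⟨n, rfl⟩
    rw [← hclosed.closure_eq, Metric.mem_closure_range_iff]
    intro ε hε
    obtain ⟨m, hm⟩ := exists_nat_one_div_lt hε
    obtain ⟨x, hx⟩ := Set.mem_iUnion.mp (Set.mem_iInter.mp (Set.mem_iInter.mp hTU n) m)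
    exact ⟨x, by rw [dist_comm]; exact lt_trans hx hm⟩
  intro y
  exact hclosed.closure_subset_iff.mpr hsub (TopologicalSpace.denseRange_denseSeq H y)
end

section
/- Let H be a separable infinite-dimensional complex Hilbert space. The set of unitary operators on H is dense in the set of all linear isometries of H into itself with respect to the strong operator topology. -/
/-- A linear isometry agrees with a surjective one on any finite-dimensional subspace. -/
theorem exists_surjective_isometry_eqOn {𝕜 H : Type*} [RCLike 𝕜] [NormedAddCommGroup H]
    [InnerProductSpace 𝕜 H] (T : H →L[𝕜] H) (hT : ∀ x, ‖T x‖ = ‖x‖) (S : Submodule 𝕜 H)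
    [FiniteDimensional 𝕜 S] :
    ∃ U : H →L[𝕜] H, (∀ x, ‖U x‖ = ‖x‖) ∧ Function.Surjective U ∧ ∀ x ∈ S, U x = T x := by
  -- Extend `T|S` to an isometry `V` of `W = S + T S`, and let `U` be the identity on `Wᗮ`.
  let W : Submodule 𝕜 H := S ⊔ S.map (T : H →ₗ[𝕜] H)
  let L : S.submoduleOf W →ₗᵢ[𝕜] W :=
    { toLinearMap := ((T : H →ₗ[𝕜] H) ∘ₗ W.subtype ∘ₗ (S.submoduleOf W).subtype).codRestrict W
        fun x => Submodule.mem_sup_right (Submodule.mem_map_of_mem x.2)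
      norm_map' := fun x => hT _ }
  let V : W →ₗᵢ[𝕜] W := L.extend
  have hV : Function.Surjective V :=
    LinearMap.surjective_of_injective (f := V.toLinearMap) V.injective
  let P := W.orthogonalProjectionOnto
  let U : H →L[𝕜] H :=
    W.subtypeL ∘L V.toContinuousLinearMap ∘L P + (ContinuousLinearMap.id 𝕜 H - W.subtypeL ∘L P)
  have hU (x : H) : U x = V (P x) + (x - P x) := rfl
  have hperp (x : H) : x - P x ∈ Wᗮ := W.sub_starProjection_mem_orthogonal x
  have hnorm (w : W) (z : H) (hz : z ∈ Wᗮ) :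
      ‖(w : H) + z‖ * ‖(w : H) + z‖ = ‖w‖ * ‖w‖ + ‖z‖ * ‖z‖ :=
    norm_add_sq_eq_norm_sq_add_norm_sq_of_inner_eq_zero (𝕜 := 𝕜) _ _
      (Submodule.inner_right_of_mem_orthogonal w.2 hz)
  refine ⟨U, fun x => ?_, fun y => ?_, fun x hx => ?_⟩
  · rw [← mul_self_inj (norm_nonneg _) (norm_nonneg _), hU, hnorm _ _ (hperp x), V.norm_map,
      ← hnorm _ _ (hperp x), add_sub_cancel]
  · obtain ⟨w, hw⟩ := hV (P y)
    have hP : P (w + (y - P y)) = w := by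
      rw [map_add, W.orthogonalProjectionOnto_mem_subspace_eq_self,
        W.orthogonalProjectionOnto_apply_of_mem_orthogonal (hperp y), add_zero]
    refine ⟨w + (y - P y), ?_⟩
    rw [hU, hP, hw]
    abel
  · have hxW : x ∈ W := Submodule.mem_sup_left hx
    have hP : P x = ⟨x, hxW⟩ := W.orthogonalProjectionOnto_mem_subspace_eq_self ⟨x, hxW⟩
    have hVx : V ⟨x, hxW⟩ = L ⟨⟨x, hxW⟩, hx⟩ := L.extend_apply ⟨⟨x, hxW⟩, hx⟩
    rw [hU, hP, hVx, sub_self, add_zero]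
    rfl

/-- On a separable infinite-dimensional complex Hilbert space, the set of unitary
operators (surjective isometries) is dense in the set of all linear isometries,
with respect to the strong operator topology. -/
theorem unitaries_dense_in_isometries_sot
    {H : Type*} [NormedAddCommGroup H] [InnerProductSpace ℂ H] [CompleteSpace H]
    [TopologicalSpace.SeparableSpace H] (hinf : ¬ FiniteDimensional ℂ H) :
    @Dense {T : H →L[ℂ] H // ∀ x : H, ‖T x‖ = ‖x‖}
      (TopologicalSpace.induced
        (fun (T : {T : H →L[ℂ] H // ∀ x : H, ‖T x‖ = ‖x‖}) (x : H) => T.1 x)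
        Pi.topologicalSpace)
      {T | Function.Surjective (T.1 : H → H)} := by
  intro T
  let : TopologicalSpace {T : H →L[ℂ] H // ∀ x : H, ‖T x‖ = ‖x‖} :=
    TopologicalSpace.induced (fun T (x : H) => T.1 x) Pi.topologicalSpace
  rw [mem_closure_iff]
  rintro _ ⟨s, hs, rfl⟩ hTs
  obtain ⟨I, u, hu, hIs⟩ := isOpen_pi_iff.mp hs _ hTs
  obtain ⟨U, hU, hsurj, hUT⟩ :=
    exists_surjective_isometry_eqOn T.1 T.2 (Submodule.span ℂ (I : Set H))
  refine ⟨⟨U, hU⟩, hIs fun x hx => ?_, hsurj⟩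
  simpa only [hUT x (Submodule.subset_span hx)] using (hu x hx).2
end

section
/- Let H be a separable infinite-dimensional complex Hilbert space, let x ∈ H be nonzero, and let ε > 0. Then the set M = {T : T is a linear isometry of H and dist(x, range T) ≥ ε} is nowhere dense in the set of all linear isometries of H equipped with the strong operator topology. -/
/-- Given an isometry `T`, a finite-dimensional subspace `F` and a vector `x` of an
infinite-dimensional Hilbert space, some isometry agrees with `T` on `F` and has `x` in its
range. -/
theorem exists_isometry_eqOn_and_mem_range
    {H : Type*} [NormedAddCommGroup H] [InnerProductSpace ℂ H] [CompleteSpace H]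
    (hinf : ¬ FiniteDimensional ℂ H) (T : H →L[ℂ] H) (hT : ∀ y : H, ‖T y‖ = ‖y‖)
    (F : Submodule ℂ H) [FiniteDimensional ℂ F] (x : H) :
    ∃ S : H →L[ℂ] H, (∀ y : H, ‖S y‖ = ‖y‖) ∧ (∀ y ∈ F, S y = T y) ∧ ∃ z, S z = x := by
  have inner_T : ∀ y z : H, inner ℂ (T y) (T z) = inner ℂ y z :=
    (LinearIsometry.mk T.toLinearMap hT).inner_map_map
  obtain ⟨u, huF, hux, hu⟩ : ∃ u : H, (∀ y ∈ F, inner ℂ y u = 0) ∧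
      inner ℂ x (T u) = 0 ∧ ‖u‖ = 1 := by
    let G : Submodule ℂ H := F ⊔ Submodule.span ℂ {ContinuousLinearMap.adjoint T x}
    have hG : Gᗮ ≠ ⊥ := fun h => by
      rw [Submodule.orthogonal_eq_bot_iff] at h
      have hfin : FiniteDimensional ℂ G := inferInstance
      rw [h] at hfin
      exact hinf (Module.finite_def.2 ((Submodule.fg_top _).1 (Module.finite_def.1 hfin)))
    obtain ⟨v, hvG, hv⟩ := Submodule.exists_mem_ne_zero_of_ne_bot hG
    have hmem := (Submodule.mem_orthogonal _ _).1 (Gᗮ.smul_mem ((‖v‖ : ℂ)⁻¹) hvG)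
    refine ⟨(‖v‖ : ℂ)⁻¹ • v, fun y hy => hmem y (Submodule.mem_sup_left hy), ?_, ?_⟩
    · rw [← ContinuousLinearMap.adjoint_inner_left]
      exact hmem _ (Submodule.mem_sup_right (Submodule.mem_span_singleton_self _))
    · exact norm_smul_inv_norm hv
  let V : Submodule ℂ H := F.map T.toLinearMap
  obtain ⟨f, hf, hfx⟩ : ∃ f ∈ F, T f = V.starProjection x := V.starProjection_apply_mem x
  set b : H := x - T f with hb
  set a : H := (‖b‖ : ℂ) • T u with ha
  have hbF : ∀ y ∈ F, inner ℂ (T y) b = 0 := fun y hy => by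
    rw [hb, hfx]
    exact V.sub_starProjection_mem_orthogonal x (T y) (Submodule.mem_map_of_mem hy)
  have haF : ∀ y ∈ F, inner ℂ (T y) a = 0 := fun y hy => by
    rw [ha, inner_smul_right, inner_T, huF y hy, mul_zero]
  have hba : inner ℂ b a = 0 := by
    rw [ha, inner_smul_right, hb, inner_sub_left, hux, inner_T, huF f hf, sub_zero, mul_zero]
  have hab : inner ℂ a b = 0 := inner_eq_zero_symm.1 hba
  have hnorm : ‖a‖ = ‖b‖ := by
    rw [ha, norm_smul, hT, hu, mul_one, Complex.norm_real, norm_norm]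
  let K : Submodule ℂ H := Submodule.span ℂ {a - b}
  have hfix : ∀ y ∈ F, Kᗮ.reflection (T y) = T y := fun y hy => by
    rw [Submodule.reflection_eq_self_iff, Submodule.mem_orthogonal_singleton_iff_inner_left,
      inner_sub_right, hbF y hy, haF y hy, sub_zero]
  have hsum : Kᗮ.reflection (a + b) = a + b := by
    rw [Submodule.reflection_eq_self_iff, Submodule.mem_orthogonal_singleton_iff_inner_left,
      inner_sub_right, inner_add_left, inner_add_left, hab, hba, inner_self_eq_norm_sq_to_K,
      inner_self_eq_norm_sq_to_K, hnorm]
    ring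
  have hdiff : Kᗮ.reflection (a - b) = -(a - b) :=
    Submodule.reflection_orthogonalComplement_singleton_eq_neg (𝕜 := ℂ) (a - b)
  have hswap : Kᗮ.reflection a = b := by
    rw [map_add] at hsum
    rw [map_sub] at hdiff
    have h2 : (2 : ℂ) • Kᗮ.reflection a = (2 : ℂ) • b := by
      have h := congrArg₂ (· + ·) hsum hdiff
      rw [two_smul, two_smul]
      convert h using 1 <;> abel
    exact smul_right_injective H (two_ne_zero' ℂ) h2
  refine ⟨(Kᗮ.reflection : H →L[ℂ] H) ∘L T, fun y => ?_, hfix, f + (‖b‖ : ℂ) • u, ?_⟩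
  · exact (Kᗮ.reflection.norm_map (T y)).trans (hT y)
  · change Kᗮ.reflection (T (f + (‖b‖ : ℂ) • u)) = x
    rw [map_add, map_add, hfix f hf, map_smul, ← ha, hswap, hb, add_sub_cancel]


/-- Let `H` be a separable infinite-dimensional complex Hilbert space, `x ≠ 0` and
`ε > 0`. The set of isometries `T` with `dist (x, range T) ≥ ε` is nowhere dense
in the set of all isometries, endowed with the strong operator topology. -/
theorem isometries_far_range_nowhere_dense_sot
    {H : Type*} [NormedAddCommGroup H] [InnerProductSpace ℂ H] [CompleteSpace H]
    [TopologicalSpace.SeparableSpace H] (hinf : ¬ FiniteDimensional ℂ H)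
    (x : H) (hx : x ≠ 0) (ε : ℝ) (hε : 0 < ε) :
    @IsNowhereDense {T : H →L[ℂ] H // ∀ y : H, ‖T y‖ = ‖y‖}
      (TopologicalSpace.induced
        (fun (T : {T : H →L[ℂ] H // ∀ y : H, ‖T y‖ = ‖y‖}) (y : H) => T.1 y)
        Pi.topologicalSpace)
      {T | ε ≤ Metric.infDist x (Set.range (T.1 : H → H))} := by
  let τ : TopologicalSpace {T : H →L[ℂ] H // ∀ y : H, ‖T y‖ = ‖y‖} :=
    TopologicalSpace.induced (fun T (y : H) => T.1 y) Pi.topologicalSpace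
  have heval : ∀ y : H, Continuous
      fun T : {T : H →L[ℂ] H // ∀ y : H, ‖T y‖ = ‖y‖} => T.1 y := fun y =>
    (continuous_apply y).comp continuous_induced_dom
  have hclosed : IsClosed {T : {T : H →L[ℂ] H // ∀ y : H, ‖T y‖ = ‖y‖} |
      ε ≤ Metric.infDist x (Set.range (T.1 : H → H))} := by
    simp only [Metric.le_infDist (Set.range_nonempty _), Set.forall_mem_range, Set.ofPred_forall]
    exact isClosed_iInter fun y => isClosed_le continuous_const (continuous_const.dist (heval y))
  change IsNowhereDense _
  rw [hclosed.isNowhereDense_iff, Set.eq_empty_iff_forall_notMem]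
  intro T hTint
  obtain ⟨U, hUM, hU, hTU⟩ := mem_interior.1 hTint
  obtain ⟨W, hW, rfl⟩ := isOpen_induced_iff.1 hU
  obtain ⟨I, N, hN, hIN⟩ := isOpen_pi_iff.1 hW _ hTU
  obtain ⟨S, hS, hST, z, hz⟩ := exists_isometry_eqOn_and_mem_range hinf T.1 T.2
    (Submodule.span ℂ (I : Set H)) x
  have hSW : (fun y => S y) ∈ W := hIN fun y hy => by
    rw [hST y (Submodule.subset_span hy)]
    exact (hN y hy).2
  have hle : ε ≤ Metric.infDist x (Set.range S) := hUM (a := ⟨S, hS⟩) hSW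
  rw [Metric.infDist_zero_of_mem (Set.mem_range.2 ⟨z, hz⟩)] at hle
  exact hle.not_gt hε
end

section
/- Every unitary operator T on a complex Hilbert space H can be embedded into a strongly continuous one-parameter unitary group: there exists a family (U(t))_{t ∈ ℝ} of unitary operators on H with U(0) = I, U(s + t) = U(s)U(t) for all s, t ∈ ℝ, such that for every x ∈ H the map t ↦ U(t)x is continuous from ℝ to H, and U(1) = T. -/
/-- The orthogonal projection onto the kernel of `S` commutes with every self-adjoint operator
commuting with `S`. -/
lemma commute_starProjection_ker {H : Type*} [NormedAddCommGroup H] [InnerProductSpace ℂ H]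
    [CompleteSpace H] {S B : H →L[ℂ] H} (hB : IsSelfAdjoint B) (h : Commute S B) :
    Commute S.ker.starProjection B := by
  have hP : IsSelfAdjoint S.ker.starProjection := isSelfAdjoint_starProjection _
  have hinv : S.ker.starProjection * (B * S.ker.starProjection) = B * S.ker.starProjection := by
    ext x
    refine Submodule.starProjection_eq_self_iff.mpr ?_
    have hx : S (S.ker.starProjection x) = 0 := S.ker.starProjection_apply_mem x
    have hc := DFunLike.congr_fun h.eq (S.ker.starProjection x)
    simpa [hx] using hc
  have hadj := congrArg star hinv
  simp only [star_mul, hP.star_eq, hB.star_eq] at hadj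
  rw [commute_iff_eq, ← hinv, ← hadj, mul_assoc]

/-- If `S * R = 0` with `R` self-adjoint, then `R` absorbs the projection onto the kernel of `S`. -/
lemma mul_starProjection_ker_eq_self {H : Type*} [NormedAddCommGroup H] [InnerProductSpace ℂ H]
    [CompleteSpace H] {S R : H →L[ℂ] H} (hR : IsSelfAdjoint R) (h : S * R = 0) :
    R * S.ker.starProjection = R := by
  have hP : IsSelfAdjoint S.ker.starProjection := isSelfAdjoint_starProjection _
  have hPR : S.ker.starProjection * R = R := by
    ext x
    exact Submodule.starProjection_eq_self_iff.mpr (DFunLike.congr_fun h x)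
  simpa [star_mul, hP.star_eq, hR.star_eq] using congrArg star hPR

lemma mul_starProjection_ker {H : Type*} [NormedAddCommGroup H] [InnerProductSpace ℂ H]
    [CompleteSpace H] (S : H →L[ℂ] H) : S * S.ker.starProjection = 0 := by
  ext x
  exact S.ker.starProjection_apply_mem x

/-- Exponential of `X` twisted by the symmetry `2 * P - 1`. -/
lemma exp_symmetry_mul {A : Type*} [NormedRing A] [NormedAlgebra ℂ A] [CompleteSpace A]
    {P X : A} (hP : P * P = P) (h : Commute P X) :
    NormedSpace.exp ((2 * P - 1) * X) =
      NormedSpace.exp X * P + NormedSpace.exp (-X) * (1 - P) := by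
  let _ := NormedAlgebra.restrictScalars ℚ ℂ A
  have h1 : SemiconjBy P ((2 * P - 1) * X) X := by
    have : P * ((2 * P - 1) * X) = (2 * (P * P) - P) * X := by noncomm_ring
    rw [SemiconjBy, this, hP, ← h.eq]
    noncomm_ring
  have h2 : SemiconjBy (1 - P) ((2 * P - 1) * X) (-X) := by
    have : (1 - P) * ((2 * P - 1) * X) = (3 * P - 2 * (P * P) - 1) * X := by noncomm_ring
    have h' : -X * (1 - P) = X * P - X := by noncomm_ring
    rw [SemiconjBy, this, hP, h', ← h.eq]
    noncomm_ring
  rw [← h1.exp_right.eq, ← h2.exp_right.eq]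
  noncomm_ring

lemma Complex.exp_arccos_re_mul_I {z : ℂ} (hz : ‖z‖ = 1) :
    Complex.exp (Real.arccos z.re * Complex.I) = z.re + |z.im| * Complex.I := by
  have h := Complex.abs_re_le_norm z
  rw [hz, abs_le] at h
  have hsq : 1 - z.re ^ 2 = z.im ^ 2 := by
    have := Complex.sq_norm z
    rw [hz, Complex.normSq_apply] at this
    linarith
  rw [Complex.exp_mul_I, ← Complex.ofReal_cos, ← Complex.ofReal_sin, Real.cos_arccos h.1 h.2,
    Real.sin_arccos, hsq, Real.sqrt_sq_eq_abs]

lemma exp_smul_cfc {A : Type*} [CStarAlgebra A] {a : A} [IsStarNormal a] (c : ℂ) {f : ℂ → ℂ}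
    (hf : Continuous f) :
    NormedSpace.exp (c • cfc f a) = cfc (fun z => Complex.exp (c * f z)) a := by
  have hc : c • cfc f a = cfc (fun z => c * f z) a := (cfc_const_mul c f a hf.continuousOn).symm
  have hn : IsStarNormal (c • cfc f a) := hc ▸ cfc_predicate _ a
  rw [← CFC.complex_exp_eq_normedSpace_exp hn, hc]
  exact (cfc_comp' Complex.exp _ a Complex.continuous_exp.continuousOn (by fun_prop)).symm

lemma cfc_id_add_smul {A : Type*} [CStarAlgebra A] {a : A} [IsStarNormal a] (c : ℂ) {f : ℂ → ℂ}
    (hf : Continuous f) :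
    cfc (fun z => z + c * f z) a = a + c • cfc f a := by
  rw [cfc_add a (fun z => z) (fun z => c * f z) continuousOn_id (by fun_prop), cfc_id' ℂ a,
    cfc_const_mul c f a hf.continuousOn]

/-- Every unitary operator is the exponential of `i` times a bounded self-adjoint operator. -/
theorem exists_isSelfAdjoint_exp_I_smul_eq {H : Type*} [NormedAddCommGroup H]
    [InnerProductSpace ℂ H] [CompleteSpace H] {T : H →L[ℂ] H} (hT : T ∈ unitary (H →L[ℂ] H)) :
    ∃ A : H →L[ℂ] H, IsSelfAdjoint A ∧ NormedSpace.exp (Complex.I • A) = T := by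
  have hN : IsStarNormal T := isStarNormal_of_mem_unitary hT
  have hnorm : ∀ z ∈ spectrum ℂ T, ‖z‖ = 1 := fun z hz => by
    simpa using spectrum.subset_circle_of_unitary hT hz
  have hsa : ∀ f : ℂ → ℝ, IsSelfAdjoint (cfc (fun z => (f z : ℂ)) T) := fun f => by
    rw [IsSelfAdjoint, ← cfc_star]
    simp
  set B := cfc (fun z : ℂ => (Real.arccos z.re : ℂ)) T with hBdef
  set S := cfc (fun z : ℂ => ((|z.im| - z.im : ℝ) : ℂ)) T with hSdef
  set R := cfc (fun z : ℂ => ((|z.im| + z.im : ℝ) : ℂ)) T with hRdef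
  have hB : IsSelfAdjoint B := hsa _
  have hR : IsSelfAdjoint R := hsa _
  have hSR : S * R = 0 := by
    rw [hSdef, hRdef, ← cfc_mul _ _ T, ← cfc_zero ℂ T]
    refine cfc_congr fun z _ => ?_
    have : (|z.im| - z.im) * (|z.im| + z.im) = 0 := by
      linear_combination abs_mul_abs_self z.im
    simp only [Pi.zero_apply]
    exact_mod_cast this
  have hSB : Commute S B := cfc_commute_cfc _ _ T
  set P := S.ker.starProjection with hPdef
  have hP : IsSelfAdjoint P := isSelfAdjoint_starProjection _
  have hPP : P * P = P := S.ker.isIdempotentElem_starProjection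
  have hPB : Commute P B := commute_starProjection_ker hB hSB
  have hexp : NormedSpace.exp (Complex.I • B) = T + Complex.I • S := by
    rw [hBdef, hSdef, exp_smul_cfc _ (by fun_prop), ← cfc_id_add_smul _ (by fun_prop)]
    refine cfc_congr fun z hz => ?_
    simp only [mul_comm Complex.I, Complex.exp_arccos_re_mul_I (hnorm z hz)]
    apply Complex.ext <;> simp
  have hexp' : NormedSpace.exp (-(Complex.I • B)) = T - Complex.I • R := by
    rw [← neg_smul, sub_eq_add_neg, ← neg_smul, hBdef, hRdef, exp_smul_cfc _ (by fun_prop),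
      ← cfc_id_add_smul _ (by fun_prop)]
    refine cfc_congr fun z hz => ?_
    have h : Complex.exp (-(Real.arccos z.re * Complex.I)) = z.re - |z.im| * Complex.I := by
      have := congrArg (starRingEnd ℂ) (Complex.exp_arccos_re_mul_I (hnorm z hz))
      rw [← Complex.exp_conj] at this
      simpa [sub_eq_add_neg] using this
    simp only [neg_mul, mul_comm Complex.I, h]
    apply Complex.ext <;> simp
  refine ⟨(2 * P - 1) * B, ?_, ?_⟩
  · have hc : Commute (2 * P - 1) B :=
      (((Commute.ofNat_left 2 B).mul_left hPB).sub_left (Commute.one_left B))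
    have hW : IsSelfAdjoint (2 * P - 1) := by
      rw [two_mul]
      exact (hP.add hP).sub (.one _)
    exact (hW.commute_iff hB).mp hc
  · rw [← mul_smul_comm, exp_symmetry_mul hPP (hPB.smul_right _), hexp, hexp', add_mul, sub_mul,
      smul_mul_assoc, smul_mul_assoc, mul_starProjection_ker, mul_sub R,
      mul_starProjection_ker_eq_self hR hSR]
    simp [mul_sub]


/-- Every unitary operator `T` (surjective isometry) on a complex Hilbert space
can be embedded into a strongly continuous one-parameter unitary group:
there is a family `(U t)_{t ∈ ℝ}` of unitary operators with `U 0 = 1`,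
`U (s + t) = U s ∘ U t`, `t ↦ U t x` continuous for every `x`, and `U 1 = T`. -/
theorem unitary_embeds_into_unitary_group
    {H : Type*} [NormedAddCommGroup H] [InnerProductSpace ℂ H] [CompleteSpace H]
    (T : H →L[ℂ] H) (hTiso : ∀ x : H, ‖T x‖ = ‖x‖)
    (hTsurj : Function.Surjective (T : H → H)) :
    ∃ U : ℝ → H →L[ℂ] H,
      (∀ t : ℝ, (∀ x : H, ‖U t x‖ = ‖x‖) ∧ Function.Surjective ((U t : H →L[ℂ] H) : H → H)) ∧
      U 0 = 1 ∧
      (∀ s t : ℝ, U (s + t) = (U s).comp (U t)) ∧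
      (∀ x : H, Continuous fun t : ℝ => U t x) ∧
      U 1 = T := by
  have hT : T ∈ unitary (H →L[ℂ] H) := by
    have h1 : star T * T = 1 := T.norm_map_iff_adjoint_comp_self.mp hTiso
    refine Unitary.mem_iff.mpr ⟨h1, ?_⟩
    ext y
    obtain ⟨x, rfl⟩ := hTsurj y
    exact congrArg T (DFunLike.congr_fun h1 x)
  obtain ⟨A, hA, hexp⟩ := exists_isSelfAdjoint_exp_I_smul_eq hT
  let _ := NormedAlgebra.restrictScalars ℚ ℂ (H →L[ℂ] H)
  have hadd : ∀ s t : ℝ, NormedSpace.exp ((s + t) • Complex.I • A) =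
      NormedSpace.exp (s • Complex.I • A) * NormedSpace.exp (t • Complex.I • A) := fun s t => by
    rw [add_smul]
    exact NormedSpace.exp_add_of_commute
      (((Commute.refl (Complex.I • A)).smul_left s).smul_right t)
  refine ⟨fun t => NormedSpace.exp (t • Complex.I • A), fun t => ?_, by simp, hadd, fun x => ?_,
    by simpa using hexp⟩
  · have hu : NormedSpace.exp (t • Complex.I • A) ∈ unitary (H →L[ℂ] H) := by
      refine NormedSpace.exp_mem_unitary_of_mem_skewAdjoint ?_
      exact skewAdjoint.smul_mem t (hA.smul_mem_skewAdjoint Complex.conj_I)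
    obtain ⟨h1, h2⟩ := Unitary.mem_iff.mp hu
    exact ⟨(ContinuousLinearMap.norm_map_iff_adjoint_comp_self _).mpr h1,
      fun y => ⟨_, DFunLike.congr_fun h2 y⟩⟩
  · have hc : Continuous fun t : ℝ => NormedSpace.exp (t • Complex.I • A) :=
      NormedSpace.exp_continuous.comp (by fun_prop)
    exact hc.clm_apply continuous_const
end

section
/- Let H be a separable infinite-dimensional complex Hilbert space. The set of linear isometries T on H that can be embedded into a strongly continuous semigroup — i.e., for which there exists a family (T(t))_{t ≥ 0} of bounded linear operators on H with T(0) = I, T(s + t) = T(s)T(t) for all s, t ≥ 0, t ↦ T(t)x continuous on [0, ∞) for every x ∈ H, and T(1) = T — is residual in the set of all linear isometries of H equipped with the strong operator topology. -/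
open Filter Topology

/-- The continuous function `(1 + z) z ^ t` on the unit circle. -/
noncomputable def dampedPow (t : NNReal) (z : ℂ) : ℂ := (1 + z) * z ^ ((t : ℝ) : ℂ)

theorem norm_dampedPow (t : NNReal) {z : ℂ} (hz : ‖z‖ = 1) : ‖dampedPow t z‖ = ‖1 + z‖ := by
  simp [dampedPow, Complex.norm_cpow_real, hz]

open scoped ComplexOrder in
theorem continuousOn_dampedPow :
    ContinuousOn (fun p : NNReal × ℂ => dampedPow p.1 p.2)
      (Set.univ ×ˢ Metric.sphere (0 : ℂ) 1) := by
  rintro ⟨t, z⟩ ⟨-, hz⟩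
  have hz1 : ‖z‖ = 1 := by simpa using hz
  by_cases h : z = -1
  · subst h
    have h0 : Tendsto (fun p : NNReal × ℂ => ‖1 + p.2‖)
        (𝓝[Set.univ ×ˢ Metric.sphere (0 : ℂ) 1] (t, -1)) (𝓝 0) := by
      have : Continuous fun p : NNReal × ℂ => ‖1 + p.2‖ := by fun_prop
      simpa using (this.tendsto (t, -1)).mono_left nhdsWithin_le_nhds
    have h1 : dampedPow t (-1) = 0 := by simp [dampedPow]
    rw [ContinuousWithinAt, h1]
    refine squeeze_zero_norm' ?_ h0
    filter_upwards [self_mem_nhdsWithin] with p hp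
    exact (norm_dampedPow _ (by simpa using hp)).le
  · have hs : z ∈ Complex.slitPlane := by
      rw [Complex.mem_slitPlane_iff_not_le_zero]
      intro hle
      apply h
      have := Complex.eq_coe_norm_of_nonneg (neg_nonneg.mpr hle)
      rw [norm_neg, hz1] at this
      rw [← neg_neg z, this]; simp
    have : ContinuousAt (fun p : NNReal × ℂ => (1 + p.2) * p.2 ^ ((p.1 : ℝ) : ℂ)) (t, z) := by
      refine ContinuousAt.mul (by fun_prop) ?_
      exact ContinuousAt.cpow (by fun_prop)
        (Continuous.continuousAt (by fun_prop)) hs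
    exact this.continuousWithinAt

theorem continuousOn_dampedPow_right (t : NNReal) :
    ContinuousOn (dampedPow t) (Metric.sphere (0 : ℂ) 1) :=
  continuousOn_dampedPow.comp (f := fun z => (t, z)) (by fun_prop) (fun _ hz => ⟨trivial, hz⟩)

theorem dampedPow_mul_dampedPow (s t : NNReal) {z : ℂ} (hz : ‖z‖ = 1) :
    dampedPow s z * dampedPow t z = dampedPow (s + t) z * (1 + z) := by
  have : z ≠ 0 := by rintro rfl; simp at hz
  simp only [dampedPow, NNReal.coe_add, Complex.ofReal_add, Complex.cpow_add _ _ this]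
  ring

section Isometries

variable {H : Type*} [NormedAddCommGroup H] [InnerProductSpace ℂ H]

section Powers

variable [CompleteSpace H]

/-- `(1 + U) U ^ t`, for a unitary operator `U`. -/
noncomputable def cfcDampedPow (U : H →L[ℂ] H) (t : NNReal) : H →L[ℂ] H := cfc (dampedPow t) U

section Unitary

variable {U : H →L[ℂ] H} (hU : U ∈ unitary (H →L[ℂ] H))
include hU

theorem continuousOn_dampedPow_spectrum (t : NNReal) :
    ContinuousOn (dampedPow t) (spectrum ℂ U) :=
  (continuousOn_dampedPow_right t).mono (spectrum.subset_circle_of_unitary hU)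

theorem cfc_one_add : cfc (fun z : ℂ => 1 + z) U = 1 + U := by
  have := isStarNormal_of_mem_unitary hU
  rw [cfc_const_add (1 : ℂ) (fun z => z) U, cfc_id' ℂ U, map_one]

theorem cfcDampedPow_zero : cfcDampedPow U 0 = 1 + U := by
  rw [← cfc_one_add hU, cfcDampedPow]
  congr 1
  ext z
  simp [dampedPow]

theorem cfcDampedPow_one : cfcDampedPow U 1 = (1 + U) * U := by
  have := isStarNormal_of_mem_unitary hU
  have h : dampedPow 1 = fun z => (1 + z) * z := by
    ext z
    simp [dampedPow]
  rw [cfcDampedPow, h, cfc_mul (fun z : ℂ => 1 + z) (fun z => z) U, cfc_one_add hU, cfc_id' ℂ U]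

theorem cfcDampedPow_mul_one_add (t : NNReal) :
    cfcDampedPow U t * (1 + U) = (1 + U) * cfcDampedPow U t := by
  have hc := continuousOn_dampedPow_spectrum hU t
  rw [← cfc_one_add hU, cfcDampedPow, ← cfc_mul _ _ U, ← cfc_mul _ _ U]
  simp only [mul_comm]

theorem cfcDampedPow_mul (s t : NNReal) :
    cfcDampedPow U s * cfcDampedPow U t = cfcDampedPow U (s + t) * (1 + U) := by
  have hc := continuousOn_dampedPow_spectrum hU
  rw [← cfc_one_add hU, cfcDampedPow, cfcDampedPow, cfcDampedPow,
    ← cfc_mul _ _ U (hc s) (hc t), ← cfc_mul _ _ U (hc (s + t))]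
  exact cfc_congr fun z hz =>
    dampedPow_mul_dampedPow s t (spectrum.norm_eq_one_of_unitary hU hz)

theorem star_cfcDampedPow_mul_self (t : NNReal) :
    star (cfcDampedPow U t) * cfcDampedPow U t = star (1 + U) * (1 + U) := by
  have hc := continuousOn_dampedPow_spectrum hU t
  rw [← cfc_one_add hU, cfcDampedPow, ← cfc_star, ← cfc_star,
    ← cfc_mul _ _ U hc.star hc, ← cfc_mul _ _ U]
  refine cfc_congr fun z hz => ?_
  have h := norm_dampedPow t (spectrum.norm_eq_one_of_unitary hU hz)
  simp only [RCLike.star_def, RCLike.conj_mul, h]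

theorem norm_cfcDampedPow_apply (t : NNReal) (x : H) :
    ‖cfcDampedPow U t x‖ = ‖(1 + U) x‖ := by
  have h (A : H →L[ℂ] H) : ‖A x‖ ^ 2 = RCLike.re (inner ℂ ((star A * A) x) x) :=
    A.apply_norm_sq_eq_inner_adjoint_left x
  rw [← sq_eq_sq₀ (norm_nonneg _) (norm_nonneg _), h, h, star_cfcDampedPow_mul_self hU]

theorem continuous_cfcDampedPow : Continuous (cfcDampedPow U) := by
  have hc := continuousOn_dampedPow_spectrum hU
  refine continuous_iff_continuousAt.mpr fun t =>
    continuousAt_cfc_fun (TendstoUniformlyOn.mono ?_ (spectrum.subset_circle_of_unitary hU))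
      (Eventually.of_forall hc)
  rw [tendstoUniformlyOn_iff_tendstoUniformly_comp_coe]
  refine Continuous.tendstoUniformly
    (fun (s : NNReal) (z : Metric.sphere (0 : ℂ) 1) => dampedPow s z) ?_ t
  exact continuousOn_dampedPow.comp_continuous
    (f := fun p : NNReal × Metric.sphere (0 : ℂ) 1 => (p.1, (p.2 : ℂ))) (by fun_prop)
    (fun p => ⟨trivial, p.2.2⟩)

end Unitary

/-- The power `U ^ t` of a unitary operator `U` such that `1 + U` has dense range. -/
noncomputable def unitaryPow (U : H →L[ℂ] H) (t : NNReal) : H →L[ℂ] H :=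
  (cfcDampedPow U t).toLinearMap.extendOfNorm (1 + U).toLinearMap

section UnitaryPow

variable {U : H →L[ℂ] H} (hU : U ∈ unitary (H →L[ℂ] H)) (hd : DenseRange ⇑(1 + U))
include hU hd

theorem unitaryPow_one_add_apply (t : NNReal) (x : H) :
    unitaryPow U t ((1 + U) x) = cfcDampedPow U t x :=
  LinearMap.extendOfNorm_eq (e := (1 + U).toLinearMap) hd
    ⟨1, fun y => by simpa using (norm_cfcDampedPow_apply hU t y).le⟩ x

theorem norm_unitaryPow_apply_le (t : NNReal) (x : H) : ‖unitaryPow U t x‖ ≤ ‖x‖ := by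
  rw [← one_mul ‖x‖]
  exact LinearMap.norm_extendOfNorm_apply_le (e := (1 + U).toLinearMap) hd 1
    (fun y => by simpa using (norm_cfcDampedPow_apply hU t y).le) x

theorem unitaryPow_unique {t : NNReal} {V : H →L[ℂ] H}
    (h : V * (1 + U) = cfcDampedPow U t) : unitaryPow U t = V := by
  refine DFunLike.coe_injective (hd.equalizer (by fun_prop) (by fun_prop) ?_)
  ext x
  simpa using (unitaryPow_one_add_apply hU hd t x).trans congr($h.symm x)

theorem unitaryPow_add (s t : NNReal) :
    unitaryPow U (s + t) = (unitaryPow U s).comp (unitaryPow U t) := by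
  have hd2 : DenseRange (⇑(1 + U) ∘ ⇑(1 + U)) := hd.comp hd (by fun_prop)
  refine DFunLike.coe_injective (hd2.equalizer (by fun_prop) (by fun_prop) ?_)
  ext x
  have h1 : cfcDampedPow U t ((1 + U) x) = (1 + U) (cfcDampedPow U t x) :=
    congr($(cfcDampedPow_mul_one_add hU t) x)
  have h2 : cfcDampedPow U s (cfcDampedPow U t x) = cfcDampedPow U (s + t) ((1 + U) x) :=
    congr($(cfcDampedPow_mul hU s t) x)
  simp only [Function.comp_apply, ContinuousLinearMap.comp_apply,
    unitaryPow_one_add_apply hU hd, h1, h2]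

theorem continuous_unitaryPow_apply (x : H) : Continuous fun t => unitaryPow U t x := by
  refine continuous_of_uniform_approx_of_continuous fun u hu => ?_
  obtain ⟨ε, hε, hεu⟩ := Metric.mem_uniformity_dist.mp hu
  obtain ⟨y, hy⟩ := hd.exists_dist_lt x hε
  refine ⟨fun t => cfcDampedPow U t y, (continuous_cfcDampedPow hU).clm_apply continuous_const,
    fun t => hεu ?_⟩
  beta_reduce
  rw [← unitaryPow_one_add_apply hU hd, dist_eq_norm, ← map_sub]
  exact (norm_unitaryPow_apply_le hU hd t _).trans_lt (by rwa [← dist_eq_norm])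

theorem exists_semigroup_of_mem_unitary :
    ∃ S : NNReal → H →L[ℂ] H,
      S 0 = 1 ∧ (∀ s t : NNReal, S (s + t) = (S s).comp (S t)) ∧
      (∀ x : H, Continuous fun t : NNReal => S t x) ∧ S 1 = U :=
  ⟨unitaryPow U, unitaryPow_unique hU hd (by rw [cfcDampedPow_zero hU, one_mul]),
    unitaryPow_add hU hd, continuous_unitaryPow_apply hU hd,
    unitaryPow_unique hU hd (by rw [cfcDampedPow_one hU, mul_add, add_mul, mul_one, one_mul])⟩

end UnitaryPow

end Powers

/-- The linear isometries of `H`, with the strong operator topology. -/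
def SOTIsometry (H : Type*) [NormedAddCommGroup H] [InnerProductSpace ℂ H] : Type _ :=
  {T : H →L[ℂ] H // ∀ x : H, ‖T x‖ = ‖x‖}

namespace SOTIsometry

instance : TopologicalSpace (SOTIsometry H) :=
  TopologicalSpace.induced (fun T x => T.1 x) Pi.topologicalSpace

theorem continuous_apply (x : H) : Continuous fun T : SOTIsometry H => T.1 x :=
  (_root_.continuous_apply x).comp continuous_induced_dom

theorem tendsto_iff {ι : Type*} {l : Filter ι} {f : ι → SOTIsometry H} {T : SOTIsometry H} :
    Tendsto f l (𝓝 T) ↔ ∀ x, Tendsto (fun i => (f i).1 x) l (𝓝 (T.1 x)) := by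
  rw [nhds_induced, tendsto_comap_iff, tendsto_pi_nhds]
  rfl

theorem mem_closure_of_forall_finset {D : Set (SOTIsometry H)} {T : SOTIsometry H}
    (h : ∀ F : Finset H, ∃ U ∈ D, ∀ x ∈ F, U.1 x = T.1 x) : T ∈ closure D := by
  rw [mem_closure_iff_nhds]
  intro s hs
  rw [nhds_induced, mem_comap, nhds_pi] at hs
  obtain ⟨v, hv, hvs⟩ := hs
  obtain ⟨F, t, ht, htv⟩ := Filter.mem_pi'.mp hv
  obtain ⟨U, hU, hUT⟩ := h F
  refine ⟨U, hvs (htv fun x hx => ?_), hU⟩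
  simpa only [hUT x hx] using mem_of_mem_nhds (ht x)

end SOTIsometry

theorem isGδ_setOf_denseRange {X Y ι : Type*} [TopologicalSpace X] [TopologicalSpace Y]
    [SecondCountableTopology Y] {A : X → ι → Y} (hA : ∀ i, Continuous fun x => A x i) :
    IsGδ {x | DenseRange (A x)} := by
  have h : {x | DenseRange (A x)} =
      ⋂ V ∈ TopologicalSpace.countableBasis Y, ⋃ i, (fun x => A x i) ⁻¹' V := by
    ext x
    rw [Set.mem_ofPred_eq, DenseRange, (TopologicalSpace.isBasis_countableBasis Y).dense_iff]
    simp only [Set.mem_iInter, Set.mem_iUnion, Set.mem_preimage]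
    refine forall₂_congr fun V hV => ⟨fun h => ?_, fun ⟨i, hi⟩ _ => ⟨_, hi, i, rfl⟩⟩
    obtain ⟨_, hy, i, rfl⟩ := h (TopologicalSpace.nonempty_of_mem_countableBasis hV)
    exact ⟨i, hy⟩
  rw [h]
  exact IsGδ.biInter (TopologicalSpace.countable_countableBasis Y) fun V hV =>
    (isOpen_iUnion fun i =>
      (TopologicalSpace.isOpen_of_mem_countableBasis hV).preimage (hA i)).isGδ

section Extension

variable (N : Submodule ℂ H) [N.HasOrthogonalProjection] (V : N →L[ℂ] N)

/-- The operator acting as `V` on `N` and as the identity on `Nᗮ`. -/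
noncomputable def extendById : H →L[ℂ] H :=
  N.subtypeL ∘L V ∘L N.orthogonalProjectionOnto + (1 - N.starProjection)

theorem extendById_apply (x : H) :
    extendById N V x = V (N.orthogonalProjectionOnto x) + (x - N.starProjection x) := rfl

theorem norm_extendById_apply (hV : ∀ v, ‖V v‖ = ‖v‖) (x : H) : ‖extendById N V x‖ = ‖x‖ := by
  have ho : inner ℂ (V (N.orthogonalProjectionOnto x) : H) (x - N.starProjection x) = 0 :=
    (N.sub_starProjection_mem_orthogonal x) _ (V _).2
  have ho' : inner ℂ (N.orthogonalProjectionOnto x : H) (x - N.starProjection x) = 0 :=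
    (N.sub_starProjection_mem_orthogonal x) _ (N.orthogonalProjectionOnto x).2
  have h := norm_add_sq_eq_norm_sq_add_norm_sq_of_inner_eq_zero _ _ ho
  have h' := norm_add_sq_eq_norm_sq_add_norm_sq_of_inner_eq_zero _ _ ho'
  have hx : (N.orthogonalProjectionOnto x : H) + (x - N.starProjection x) = x := by
    rw [N.starProjection_apply]; abel
  rw [hx] at h'
  rw [← sq_eq_sq₀ (norm_nonneg _) (norm_nonneg _), extendById_apply, sq, sq, h, h',
    show ‖(V (N.orthogonalProjectionOnto x) : H)‖ = ‖(N.orthogonalProjectionOnto x : H)‖ from hV _]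

theorem surjective_smul_add_smul_extendById {a b : ℂ} (hab : a + b ≠ 0)
    (h : Function.Surjective fun v => a • v + b • V v) :
    Function.Surjective fun x => a • x + b • extendById N V x := by
  intro y
  obtain ⟨v, hv⟩ := h (N.orthogonalProjectionOnto y)
  have hm := N.sub_starProjection_mem_orthogonal y
  set m := y - N.starProjection y with hmdef
  refine ⟨v + (a + b)⁻¹ • m, ?_⟩
  have hP : N.orthogonalProjectionOnto (v + (a + b)⁻¹ • m) = v := by
    simp [N.orthogonalProjectionOnto_eq_zero_iff.mpr hm]
  have hv' : a • (v : H) + b • (V v : H) = N.starProjection y := congrArg Subtype.val hv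
  have hc : a • (a + b)⁻¹ • m + b • (a + b)⁻¹ • m = m := by
    rw [← add_smul, smul_smul, mul_inv_cancel₀ hab, one_smul]
  beta_reduce
  rw [extendById_apply, N.starProjection_apply (_ + _), hP, add_sub_cancel_left, smul_add, smul_add,
    add_add_add_comm, hv', hc, hmdef, add_sub_cancel]

end Extension

theorem finite_setOf_not_surjective_add_smul {E : Type*} [AddCommGroup E] [Module ℂ E]
    [FiniteDimensional ℂ E] (V : E →ₗ[ℂ] E) :
    {c : ℂ | ¬ Function.Surjective fun v => (1 : ℂ) • v + c • V v}.Finite := by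
  refine ((Module.End.finite_hasEigenvalue V).image fun μ => -μ⁻¹).subset fun c hc => ?_
  have hc : ¬ Function.Injective ((1 : ℂ) • LinearMap.id + c • V : E →ₗ[ℂ] E) :=
    fun hi => hc (LinearMap.injective_iff_surjective.mp hi)
  rw [injective_iff_map_eq_zero] at hc
  push Not at hc
  obtain ⟨v, hv, hv0⟩ := hc
  simp only [one_smul, LinearMap.add_apply, LinearMap.id_apply, LinearMap.smul_apply] at hv
  have hc0 : c ≠ 0 := by
    rintro rfl
    exact hv0 (by simpa using hv)
  refine ⟨-c⁻¹, Module.End.hasEigenvalue_of_hasEigenvector (x := v)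
    ⟨Module.End.mem_eigenspace_iff.mpr ?_, hv0⟩, by simp⟩
  rw [neg_smul, ← smul_neg, ← eq_neg_of_add_eq_zero_right hv, inv_smul_smul₀ hc0]

theorem exists_surjective_isometry_eqOn_finset (T : SOTIsometry H) (F : Finset H) :
    ∃ U : SOTIsometry H, (∀ x ∈ F, U.1 x = T.1 x) ∧ Function.Surjective U.1 ∧
      {c : ℂ | ¬ Function.Surjective fun x => (1 : ℂ) • x + c • U.1 x}.Finite := by
  let M : Submodule ℂ H := Submodule.span ℂ F
  let N : Submodule ℂ H := M ⊔ M.map T.1.toLinearMap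
  have : FiniteDimensional ℂ M := FiniteDimensional.span_finset ℂ F
  let L : M.comap N.subtype →ₗᵢ[ℂ] N :=
    { toLinearMap := (T.1.toLinearMap ∘ₗ N.subtype ∘ₗ (M.comap N.subtype).subtype).codRestrict N
        fun s => Submodule.mem_sup_right (Submodule.mem_map_of_mem s.2)
      norm_map' := fun s => T.2 s }
  let V : N →ₗᵢ[ℂ] N := L.extend
  have hV : Function.Surjective V := LinearMap.injective_iff_surjective.mp V.injective
  refine ⟨⟨extendById N V.toContinuousLinearMap, norm_extendById_apply N _ V.norm_map⟩,
    fun x hx => ?_, ?_, ?_⟩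
  · have hxM : x ∈ M := Submodule.subset_span hx
    have hxN : x ∈ N := Submodule.mem_sup_left hxM
    have hL : V ⟨x, hxN⟩ = L ⟨⟨x, hxN⟩, hxM⟩ := L.extend_apply ⟨⟨x, hxN⟩, hxM⟩
    have hP : N.orthogonalProjectionOnto x = ⟨x, hxN⟩ :=
      N.orthogonalProjectionOnto_mem_subspace_eq_self ⟨x, hxN⟩
    change extendById N V.toContinuousLinearMap x = T.1 x
    rw [extendById_apply, N.starProjection_apply, hP, sub_self, add_zero]
    exact congrArg Subtype.val hL
  · simpa using surjective_smul_add_smul_extendById N V.toContinuousLinearMap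
      (a := 0) (b := 1) (by simp) (by simpa using hV)
  · refine ((Set.finite_singleton (-1 : ℂ)).union
      (finite_setOf_not_surjective_add_smul V.toLinearMap)).subset fun c hc => ?_
    by_contra h
    rw [Set.mem_union, not_or] at h
    exact hc (surjective_smul_add_smul_extendById N V.toContinuousLinearMap
      (fun h0 => h.1 (eq_neg_of_add_eq_zero_right h0)) (not_not.mp h.2))

theorem exists_seq_circle_tendsto_one :
    ∃ c : ℕ → Circle, Function.Injective c ∧ Tendsto c atTop (𝓝 1) := by
  refine ⟨fun n => Circle.exp (1 / ((n : ℝ) + 1)), fun m n h => ?_, ?_⟩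
  · have hπ := Real.pi_gt_three
    have harg (n : ℕ) : Complex.arg (Circle.exp (1 / ((n : ℝ) + 1))) = 1 / ((n : ℝ) + 1) := by
      have h0 : 0 < 1 / ((n : ℝ) + 1) := Nat.one_div_pos_of_nat
      have h1 : 1 / ((n : ℝ) + 1) ≤ 1 :=
        div_le_one_of_le₀ (by linarith [n.cast_nonneg (α := ℝ)]) (by positivity)
      exact Circle.arg_exp (by linarith) (by linarith)
    have h' := harg m
    simp only at h
    rw [h, harg n] at h'
    simpa using h'.symm
  · have h := (Circle.exp.continuous.tendsto 0).comp tendsto_one_div_add_atTop_nhds_zero_nat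
    rwa [Circle.exp_zero] at h

/-- The unitary operators `T` such that `1 + T` has dense range. -/
def denseRangeIsometries (H : Type*) [NormedAddCommGroup H] [InnerProductSpace ℂ H] :
    Set (SOTIsometry H) :=
  {T | DenseRange T.1} ∩ {T | DenseRange ⇑(1 + T.1)}

theorem dense_denseRangeIsometries : Dense (denseRangeIsometries H) := by
  rw [← dense_closure]
  intro T
  refine SOTIsometry.mem_closure_of_forall_finset fun F => ?_
  obtain ⟨U, hUF, hU, hfin⟩ := exists_surjective_isometry_eqOn_finset T F
  refine ⟨U, ?_, hUF⟩
  obtain ⟨c, hinj, hc⟩ := exists_seq_circle_tendsto_one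
  let W (n : ℕ) : SOTIsometry H := ⟨(c n : ℂ) • U.1, fun x => by
    rw [smul_apply, norm_smul, Circle.norm_coe, one_mul, U.2]⟩
  have hW : Tendsto W atTop (𝓝 U) := by
    refine SOTIsometry.tendsto_iff.mpr fun x => ?_
    have h : Tendsto (fun n => (c n : ℂ)) atTop (𝓝 1) :=
      (continuous_subtype_val.tendsto 1).comp hc
    simpa using! h.smul_const (U.1 x)
  refine mem_closure_of_tendsto hW ?_
  have hinj' : Function.Injective fun n => (c n : ℂ) := Circle.coe_injective.comp hinj
  have hev := hinj'.tendsto_cofinite hfin.compl_mem_cofinite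
  rw [Nat.cofinite_eq_atTop] at hev
  filter_upwards [hev] with n hn
  refine ⟨Function.Surjective.denseRange fun y => ?_, ?_⟩
  · obtain ⟨x, hx⟩ := hU ((c n : ℂ)⁻¹ • y)
    refine ⟨x, ?_⟩
    change (c n : ℂ) • U.1 x = y
    rw [hx, smul_inv_smul₀ (Circle.coe_ne_zero _)]
  · have hs : Function.Surjective fun x => (1 : ℂ) • x + (c n : ℂ) • U.1 x := not_not.mp hn
    simp only [one_smul] at hs
    exact hs.denseRange

theorem isGδ_denseRangeIsometries [SecondCountableTopology H] :
    IsGδ (denseRangeIsometries H) := by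
  refine (isGδ_setOf_denseRange SOTIsometry.continuous_apply).inter
    (isGδ_setOf_denseRange fun x => ?_)
  exact continuous_const.add (SOTIsometry.continuous_apply x)

theorem mem_unitary_of_denseRange [CompleteSpace H] {T : SOTIsometry H} (h : DenseRange T.1) :
    T.1 ∈ unitary (H →L[ℂ] H) := by
  have hi : Isometry T.1 := AddMonoidHomClass.isometry_of_norm _ T.2
  have hs : Function.Surjective T.1 := by
    rw [← Set.range_eq_univ, ← hi.isClosedEmbedding.isClosed_range.closure_eq]
    exact h.closure_range
  let e : H ≃ₗᵢ[ℂ] H := LinearIsometryEquiv.ofSurjective ⟨T.1.toLinearMap, T.2⟩ hs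
  exact (Unitary.linearIsometryEquiv.symm e).2

end Isometries

/-- On a separable infinite-dimensional complex Hilbert space, the set of
isometries that can be embedded into a strongly continuous semigroup
(`C₀`-semigroup, parametrized by `t ∈ [0, ∞) = ℝ≥0`) is residual — its complement
is meagre — in the set of all isometries with the strong operator topology. -/
theorem embeddable_isometries_residual_sot
    {H : Type*} [NormedAddCommGroup H] [InnerProductSpace ℂ H] [CompleteSpace H]
    [TopologicalSpace.SeparableSpace H] (hinf : ¬ FiniteDimensional ℂ H) :
    @IsMeagre {T : H →L[ℂ] H // ∀ x : H, ‖T x‖ = ‖x‖}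
      (TopologicalSpace.induced
        (fun (T : {T : H →L[ℂ] H // ∀ x : H, ‖T x‖ = ‖x‖}) (x : H) => T.1 x)
        Pi.topologicalSpace)
      {T | ¬ ∃ S : NNReal → H →L[ℂ] H,
            S 0 = 1 ∧
            (∀ s t : NNReal, S (s + t) = (S s).comp (S t)) ∧
            (∀ x : H, Continuous fun t : NNReal => S t x) ∧
            S 1 = T.1} := by
  have := UniformSpace.secondCountable_of_separable H
  have h : denseRangeIsometries H ∈ residual (SOTIsometry H) :=
    residual_of_dense_Gδ isGδ_denseRangeIsometries dense_denseRangeIsometries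
  exact mem_of_superset h fun T hT hT' =>
    hT' (exists_semigroup_of_mem_unitary (mem_unitary_of_denseRange hT.1) hT.2)
end
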